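/- The class FSIAS_e has a 0–1 law: for every first-order sentence σ in the signature with one unary function symbol f, one constant symbol e, and one ternary relation symbol T, the limit as n → ∞ of the fraction of FSIAS_e structures with universe {1,…,n} that satisfy σ exists and is equal to 0 or 1. -/

import Mathlib

open Filter Topology FirstOrder

/-- Function symbols of the signature `{f, e, T}`: a unary `f` and a constant `e`. -/
inductive SigFunc : ℕ → Type
  | f : SigFunc 1
  | e : SigFunc 0

/-- Relation symbols of the signature `{f, e, T}`: one ternary relation `T`. -/
inductive SigRel : ℕ → Type
  | t : SigRel 3

/-- The first-order signature with one unary function symbol `f`, one constant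
symbol `e`, and one ternary relation symbol `T`. -/
def sigLang : Language := ⟨SigFunc, SigRel⟩

/-- Labelled data for `FSIAS_e` structures on the universe `Fin n`. -/
abbrev FSIASeData (n : ℕ) :=
  (Fin n → Fin n) × Fin n × Finset (Fin n × Fin n × Fin n)

/-- Membership in `FSIAS_e`: `f = id`, (IP), and (II). -/
def IsFSIASeOn {n : ℕ} (M : FSIASeData n) : Prop :=
  (∀ x, M.1 x = x) ∧
  (∀ a b c : Fin n, (a, b, c) ∈ M.2.2 → (M.1 a, c, b) ∈ M.2.2 ∧ (c, M.1 b, a) ∈ M.2.2) ∧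
  (∀ a b : Fin n, a = b ↔ (a, M.2.1, b) ∈ M.2.2)

/-- The `sigLang`-structure on `Fin n` determined by `M`. -/
def toStructure {n : ℕ} (M : FSIASeData n) : sigLang.Structure (Fin n) where
  funMap {l} F v :=
    match F with
    | .f => M.1 (v 0)
    | .e => M.2.1
  RelMap {l} r v :=
    match r with
    | .t => (v 0, v 1, v 2) ∈ M.2.2

/-- `M` satisfies the first-order sentence `σ`. -/
def SatSentence {n : ℕ} (M : FSIASeData n) (σ : sigLang.Sentence) : Prop :=
  @FirstOrder.Language.Sentence.Realize sigLang (Fin n) (toStructure M) σ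

namespace FSIASe

open Finset

variable {n n₁ : ℕ}

/-- Counting through a statistic `R` that a family of injections shifts: if `act g` moves the
value of `R` by `op g`, then `R` is equidistributed. -/
theorem card_mul_card_filter_le {Ω H : Type*} [Fintype Ω] [Fintype H] [DecidableEq H]
    (R : Ω → H) (act : H → Ω → Ω) (op : H → H → H)
    (hact : ∀ g, Function.Injective (act g)) (hR : ∀ g ω, R (act g ω) = op g (R ω))
    (hop : ∀ h, Function.Injective fun g => op g h) (B : Finset H) :
    Fintype.card H * #{ω | R ω ∈ B} ≤ Fintype.card Ω * #B := by
  have key : ∀ g : H, #{ω | R ω ∈ B} ≤ #{ω | op g (R ω) ∈ B} := by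
    intro g
    have hsurj := Finite.surjective_of_injective (hact g)
    refine card_le_card_of_surjOn (act g) ?_
    intro ω hω
    obtain ⟨ω', rfl⟩ := hsurj ω
    refine ⟨ω', ?_, rfl⟩
    simpa [hR] using hω
  calc Fintype.card H * #{ω | R ω ∈ B} = ∑ _g : H, #{ω | R ω ∈ B} := by simp
    _ ≤ ∑ g : H, #{ω | op g (R ω) ∈ B} := sum_le_sum fun g _ => key g
    _ = ∑ ω : Ω, #{g | op g (R ω) ∈ B} := by
      simp only [card_filter]
      exact sum_comm
    _ ≤ ∑ _ω : Ω, #B := by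
      refine sum_le_sum fun ω _ => card_le_card_of_injOn (fun g => op g (R ω)) ?_ ((hop _).injOn)
      intro g hg
      simpa using hg
    _ = Fintype.card Ω * #B := by simp

/-- The interpretation of `T` in `M`. -/
def Rel (M : FSIASeData n) (a b c : Fin n) : Prop := (a, b, c) ∈ M.2.2

instance (M : FSIASeData n) (a b c : Fin n) : Decidable (Rel M a b c) :=
  inferInstanceAs (Decidable (_ ∈ _))

theorem isFSIASeOn_iff {M : FSIASeData n} : IsFSIASeOn M ↔ (∀ x, M.1 x = x) ∧
    (∀ a b c, Rel M a b c → Rel M a c b ∧ Rel M c b a) ∧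
    (∀ a b, a = b ↔ Rel M a M.2.1 b) := by
  unfold IsFSIASeOn Rel
  constructor <;>
  · rintro ⟨h1, h2, h3⟩
    refine ⟨h1, ?_, h3⟩
    simpa only [h1] using h2

theorem rel_swap_right {M : FSIASeData n} (h : IsFSIASeOn M) (a b c : Fin n) :
    Rel M a b c ↔ Rel M a c b :=
  ⟨fun k => ((isFSIASeOn_iff.1 h).2.1 _ _ _ k).1, fun k => ((isFSIASeOn_iff.1 h).2.1 _ _ _ k).1⟩

theorem rel_swap_outer {M : FSIASeData n} (h : IsFSIASeOn M) (a b c : Fin n) :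
    Rel M a b c ↔ Rel M c b a :=
  ⟨fun k => ((isFSIASeOn_iff.1 h).2.1 _ _ _ k).2, fun k => ((isFSIASeOn_iff.1 h).2.1 _ _ _ k).2⟩

theorem rel_swap_left {M : FSIASeData n} (h : IsFSIASeOn M) (a b c : Fin n) :
    Rel M a b c ↔ Rel M b a c := by
  rw [rel_swap_right h, rel_swap_outer h, rel_swap_right h]

theorem rel_identity {M : FSIASeData n} (h : IsFSIASeOn M) (a b : Fin n) :
    Rel M a M.2.1 b ↔ a = b :=
  ((isFSIASeOn_iff.1 h).2.2 a b).symm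

/-- The points of `A` together with one new point `x`. -/
def adjoin (A : Finset (Fin n)) (x : Fin n) (α : Option A) : Fin n := α.elim x (↑)

/-- Every one-point type over at most `k` points different from `e` is realized outside these
points and `e`. -/
def HasExtensions (k : ℕ) (M : FSIASeData n) : Prop :=
  ∀ A : Finset (Fin n), M.2.1 ∉ A → #A ≤ k → ∀ τ : Sym2 (Option A) → Bool,
    ∃ x, x ≠ M.2.1 ∧ x ∉ A ∧
      ∀ α β, decide (Rel M x (adjoin A x α) (adjoin A x β)) = τ s(α, β)

theorem HasExtensions.mono {k l : ℕ} (hkl : k ≤ l) {M : FSIASeData n} (h : HasExtensions l M) :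
    HasExtensions k M :=
  fun A hA hc => h A hA (hc.trans hkl)

section Counting

variable {e : Fin n} {A : Finset (Fin n)}

/-- The points outside `A` different from `e`. -/
abbrev Outside (e : Fin n) (A : Finset (Fin n)) := {x : Fin n // x ≠ e ∧ x ∉ A}

theorem adjoin_injective {x : Fin n} (hx : x ∉ A) : Function.Injective (adjoin A x) := by
  rintro (_ | ⟨a, ha⟩) (_ | ⟨b, hb⟩) h <;> simp only [adjoin, Option.elim] at h <;> grind

theorem adjoin_ne (he : e ∉ A) (x : Outside e A) (α : Option A) : adjoin A x α ≠ e := by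
  rcases α with _ | ⟨a, ha⟩
  · exact x.2.1
  · exact fun h => he (h ▸ ha)

/-- The symmetric ternary relation given by bits `g x s` for the triples made of an outside
point `x` and the pair `s` of points of `A` and `x`. -/
def bitsRel (g : Outside e A → Sym2 (Option A) → Bool) (a b c : Fin n) : Prop :=
  ∃ x : Outside e A, ∃ α β, ({a, b, c} : Multiset (Fin n)) = {↑x, adjoin A x α, adjoin A x β} ∧
    g x s(α, β) = true

theorem bitsRel_swap_right (g : Outside e A → Sym2 (Option A) → Bool) (a b c : Fin n) :
    bitsRel g a b c ↔ bitsRel g a c b := by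
  have h : ({a, b, c} : Multiset (Fin n)) = {a, c, b} :=
    congrArg (a ::ₘ ·) (Multiset.pair_comm b c)
  rw [bitsRel, bitsRel, h]

theorem bitsRel_swap_outer (g : Outside e A → Sym2 (Option A) → Bool) (a b c : Fin n) :
    bitsRel g a b c ↔ bitsRel g c b a := by
  have h : ({a, b, c} : Multiset (Fin n)) = {c, b, a} := by
    simp only [Multiset.insert_eq_cons, ← Multiset.singleton_add]
    abel
  rw [bitsRel, bitsRel, h]

theorem not_bitsRel (he : e ∉ A) (g : Outside e A → Sym2 (Option A) → Bool) (a b : Fin n) :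
    ¬ bitsRel g a e b := by
  rintro ⟨x, α, β, h, -⟩
  have : e ∈ ({↑x, adjoin A x α, adjoin A x β} : Multiset (Fin n)) := h ▸ by simp
  simp only [Multiset.insert_eq_cons, Multiset.mem_cons, Multiset.mem_singleton] at this
  rcases this with h | h | h
  · exact x.2.1 h.symm
  · exact adjoin_ne he x α h.symm
  · exact adjoin_ne he x β h.symm

theorem sym2_eq_of_multiset_pair_eq {X : Type*} {a b c d : X} (h : ({a, b} : Multiset X) = {c, d}) :
    s(a, b) = s(c, d) := by
  classical
  simp only [Multiset.insert_eq_cons, Multiset.cons_eq_cons, Multiset.singleton_inj] at h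
  rcases h with ⟨rfl, rfl⟩ | ⟨-, w, h₁, h₂⟩
  · rfl
  · obtain ⟨rfl, -⟩ := (Multiset.singleton_eq_cons_iff _).1 h₁
    obtain ⟨rfl, -⟩ := (Multiset.singleton_eq_cons_iff _).1 h₂
    exact Sym2.eq_swap

theorem bitsRel_adjoin (g : Outside e A → Sym2 (Option A) → Bool) (x : Outside e A)
    (α β : Option A) : bitsRel g x (adjoin A x α) (adjoin A x β) ↔ g x s(α, β) = true := by
  refine ⟨?_, fun h => ⟨x, α, β, rfl, h⟩⟩
  rintro ⟨y, γ, δ, h, hg⟩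
  have hxy : x = y := by
    have hy : (x : Fin n) ∈ ({↑y, adjoin A y γ, adjoin A y δ} : Multiset (Fin n)) := h ▸ by simp
    have aux : ∀ γ : Option A, (x : Fin n) = adjoin A y γ → x = y := by
      rintro (_ | ⟨a, ha⟩) h
      · exact Subtype.ext h
      · exact absurd (h ▸ ha : (x : Fin n) ∈ A) x.2.2
    simp only [Multiset.insert_eq_cons, Multiset.mem_cons, Multiset.mem_singleton] at hy
    rcases hy with h | h | h
    · exact Subtype.ext h
    · exact aux _ h
    · exact aux _ h
  subst hxy
  have h' := sym2_eq_of_multiset_pair_eq ((Multiset.cons_inj_right _).1 h)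
  have : s(α, β) = s(γ, δ) := by
    apply Sym2.map.injective (adjoin_injective x.2.2)
    simpa using h'
  rwa [this]

open Classical in
/-- Flip membership in `T` on the triples selected by `g`. -/
noncomputable def flip (g : Outside e A → Sym2 (Option A) → Bool) (M : FSIASeData n) :
    FSIASeData n :=
  (M.1, M.2.1, univ.filter fun t => Xor (Rel M t.1 t.2.1 t.2.2) (bitsRel g t.1 t.2.1 t.2.2))

theorem rel_flip (g : Outside e A → Sym2 (Option A) → Bool) (M : FSIASeData n) (a b c : Fin n) :
    Rel (flip g M) a b c ↔ Xor (Rel M a b c) (bitsRel g a b c) := by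
  classical
  exact mem_filter.trans (and_iff_right (mem_univ _))

theorem flip_flip (g : Outside e A → Sym2 (Option A) → Bool) (M : FSIASeData n) :
    flip g (flip g M) = M := by
  have : (flip g (flip g M)).2.2 = M.2.2 := by
    ext ⟨a, b, c⟩
    change Rel _ _ _ _ ↔ Rel _ _ _ _
    simp only [rel_flip, Xor]
    tauto
  exact Prod.ext rfl (Prod.ext rfl this)

theorem isFSIASeOn_flip (g : Outside e A → Sym2 (Option A) → Bool) (he : e ∉ A)
    {M : FSIASeData n} (h : IsFSIASeOn M) (hM : M.2.1 = e) : IsFSIASeOn (flip g M) := by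
  refine isFSIASeOn_iff.2 ⟨(isFSIASeOn_iff.1 h).1, fun a b c => ?_, fun a b => ?_⟩
  · simp only [rel_flip]
    rw [rel_swap_right h, bitsRel_swap_right]
    refine fun k => ⟨k, ?_⟩
    rwa [rel_swap_outer h, bitsRel_swap_outer, rel_swap_right h, bitsRel_swap_right]
  · rw [rel_flip]
    change _ ↔ Xor (Rel M a M.2.1 b) (bitsRel g a M.2.1 b)
    rw [rel_identity h, hM]
    simp [Xor, not_bitsRel he]

/-- The structures in `FSIAS_e` on `Fin n` with identity element `e`. -/
abbrev WithIdentity (e : Fin n) := {M : FSIASeData n // IsFSIASeOn M ∧ M.2.1 = e}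

noncomputable instance : Fintype (WithIdentity e) := Fintype.ofFinite _

/-- The type of the outside point `x` over `A`. -/
def typeBits (A : Finset (Fin n)) (M : WithIdentity e) (x : Outside e A)
    (s : Sym2 (Option A)) : Bool :=
  Sym2.lift ⟨fun α β => decide (Rel M.1 x (adjoin A x α) (adjoin A x β)), fun α β => by
    simp only [rel_swap_right M.2.1 x (adjoin A x α)]⟩ s

theorem typeBits_mk (M : WithIdentity e) (x : Outside e A) (α β : Option A) :
    typeBits A M x s(α, β) = decide (Rel M.1 x (adjoin A x α) (adjoin A x β)) := rfl

theorem card_omitting_le (he : e ∉ A) (τ : Sym2 (Option A) → Bool) :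
    (2 ^ Fintype.card (Sym2 (Option A))) ^ Fintype.card (Outside e A) *
        #{M : WithIdentity e | ∀ x, typeBits A M x ≠ τ} ≤
      Fintype.card (WithIdentity e) *
        (2 ^ Fintype.card (Sym2 (Option A)) - 1) ^ Fintype.card (Outside e A) := by
  have := card_mul_card_filter_le (Ω := WithIdentity e) (typeBits A)
    (fun g M => ⟨flip g M.1, isFSIASeOn_flip g he M.2.1 M.2.2, M.2.2⟩)
    (fun g h x s => g x s ^^ h x s) ?_ ?_ ?_
    (Fintype.piFinset fun _ : Outside e A => univ.erase τ)
  · simpa [Fintype.card_pi] using this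
  · intro g M N h
    have h' := congrArg (fun K => flip g K.1) h
    simp only [flip_flip] at h'
    exact Subtype.ext h'
  · intro g M
    funext x s
    induction s with | _ α β =>
    simp only [typeBits_mk]
    have h := rel_flip g M.1 x (adjoin A x α) (adjoin A x β)
    rw [bitsRel_adjoin] at h
    by_cases h₁ : Rel M.1 x (adjoin A x α) (adjoin A x β) <;>
      by_cases h₂ : g x s(α, β) = true <;> simp [h₁, h₂] at h ⊢ <;> exact h
  · intro h g g' hg
    funext x s
    simpa using congrFun (congrFun hg x) s

end Counting

section Types

variable {m : ℕ}

/-- The value of an index: `none` stands for `e`. -/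
def point (M : FSIASeData n) (v : Fin m → Fin n) (o : Option (Fin m)) : Fin n := o.elim M.2.1 v

/-- Two tuples satisfy the same atomic formulas. -/
def AtomEquiv (M : FSIASeData n) (M' : FSIASeData n₁) (v : Fin m → Fin n) (v' : Fin m → Fin n₁) :
    Prop :=
  (∀ i j, point M v i = point M v j ↔ point M' v' i = point M' v' j) ∧
  (∀ i j k, Rel M (point M v i) (point M v j) (point M v k) ↔
    Rel M' (point M' v' i) (point M' v' j) (point M' v' k))

theorem AtomEquiv.symm {M : FSIASeData n} {M' : FSIASeData n₁} {v : Fin m → Fin n}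
    {v' : Fin m → Fin n₁} (h : AtomEquiv M M' v v') : AtomEquiv M' M v' v :=
  ⟨fun i j => (h.1 i j).symm, fun i j k => (h.2 i j k).symm⟩

theorem atomEquiv_empty {M : FSIASeData n} {M' : FSIASeData n₁} (hM : IsFSIASeOn M)
    (hM' : IsFSIASeOn M') (v : Fin 0 → Fin n) (v' : Fin 0 → Fin n₁) : AtomEquiv M M' v v' := by
  refine ⟨fun i j => by rw [Subsingleton.elim i j]; simp, fun i j k => ?_⟩
  rw [Subsingleton.elim i none, Subsingleton.elim j none, Subsingleton.elim k none]
  simp [point, rel_identity hM, rel_identity hM']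

theorem eq_castSucc_or_last (o : Option (Fin (m + 1))) :
    (∃ p : Option (Fin m), o = p.map Fin.castSucc) ∨ o = some (Fin.last m) := by
  rcases o with _ | i
  · exact Or.inl ⟨none, rfl⟩
  · induction i using Fin.lastCases with
    | last => exact Or.inr rfl
    | cast i => exact Or.inl ⟨some i, rfl⟩

@[simp]
theorem point_snoc_last (M : FSIASeData n) (v : Fin m → Fin n) (x : Fin n) :
    point M (Fin.snoc v x : Fin (m + 1) → Fin n) (some (Fin.last m)) = x := by
  simp [point]

@[simp]
theorem point_snoc_castSucc (M : FSIASeData n) (v : Fin m → Fin n) (x : Fin n)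
    (p : Option (Fin m)) :
    point M (Fin.snoc v x : Fin (m + 1) → Fin n) (p.map Fin.castSucc) = point M v p := by
  cases p <;> simp [point]

theorem AtomEquiv.snoc_point {M : FSIASeData n} {M' : FSIASeData n₁} {v : Fin m → Fin n}
    {v' : Fin m → Fin n₁} (h : AtomEquiv M M' v v') (o : Option (Fin m)) :
    AtomEquiv M M' (Fin.snoc v (point M v o) : Fin (m + 1) → Fin n)
      (Fin.snoc v' (point M' v' o) : Fin (m + 1) → Fin n₁) := by
  have key : ∀ i : Option (Fin (m + 1)), ∃ p : Option (Fin m),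
      point M (Fin.snoc v (point M v o) : Fin (m + 1) → Fin n) i = point M v p ∧
      point M' (Fin.snoc v' (point M' v' o) : Fin (m + 1) → Fin n₁) i = point M' v' p := by
    intro i
    rcases eq_castSucc_or_last i with ⟨p, rfl⟩ | rfl
    · exact ⟨p, by simp, by simp⟩
    · exact ⟨o, by simp, by simp⟩
  choose p hp hp' using key
  constructor
  · intro i j
    simpa only [hp, hp'] using h.1 (p i) (p j)
  · intro i j k
    simpa only [hp, hp'] using h.2 (p i) (p j) (p k)

theorem AtomEquiv.snoc_of_rel_iff {M : FSIASeData n} {M' : FSIASeData n₁}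
    (hM : IsFSIASeOn M) (hM' : IsFSIASeOn M') {v : Fin m → Fin n}
    {v' : Fin m → Fin n₁} (h : AtomEquiv M M' v v') {x : Fin n} {x' : Fin n₁}
    (hx : ∀ o, x ≠ point M v o) (hx' : ∀ o, x' ≠ point M' v' o)
    (hR : ∀ i j, Rel M x (point M (Fin.snoc v x : Fin (m + 1) → Fin n) i)
        (point M (Fin.snoc v x : Fin (m + 1) → Fin n) j) ↔
      Rel M' x' (point M' (Fin.snoc v' x' : Fin (m + 1) → Fin n₁) i)
        (point M' (Fin.snoc v' x' : Fin (m + 1) → Fin n₁) j)) :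
    AtomEquiv M M' (Fin.snoc v x : Fin (m + 1) → Fin n)
      (Fin.snoc v' x' : Fin (m + 1) → Fin n₁) := by
  constructor
  · intro i j
    rcases eq_castSucc_or_last i with ⟨p, rfl⟩ | rfl <;>
      rcases eq_castSucc_or_last j with ⟨q, rfl⟩ | rfl
    · simpa using h.1 p q
    · simp [(hx _).symm, (hx' _).symm]
    · simp [hx, hx']
    · simp
  · intro i j k
    rcases eq_castSucc_or_last i with ⟨p, rfl⟩ | rfl
    · rcases eq_castSucc_or_last j with ⟨q, rfl⟩ | rfl
      · rcases eq_castSucc_or_last k with ⟨r, rfl⟩ | rfl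
        · simpa using h.2 p q r
        · rw [rel_swap_outer hM, rel_swap_outer hM']
          simpa using hR (q.map Fin.castSucc) (p.map Fin.castSucc)
      · rw [rel_swap_left hM, rel_swap_left hM']
        simpa using hR (p.map Fin.castSucc) k
    · simpa using hR j k

theorem AtomEquiv.exists_snoc {M : FSIASeData n} {M' : FSIASeData n₁}
    (hM : IsFSIASeOn M) (hM' : IsFSIASeOn M') (hE : HasExtensions m M') {v : Fin m → Fin n}
    {v' : Fin m → Fin n₁} (h : AtomEquiv M M' v v') (x : Fin n) :
    ∃ x', AtomEquiv M M' (Fin.snoc v x : Fin (m + 1) → Fin n)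
      (Fin.snoc v' x' : Fin (m + 1) → Fin n₁) := by
  by_cases hx : ∃ o, x = point M v o
  · obtain ⟨o, rfl⟩ := hx
    exact ⟨_, h.snoc_point o⟩
  push Not at hx
  set A : Finset (Fin n₁) := (univ.image v').erase M'.2.1
  have hmem : ∀ a : A, ∃ i, v' i = a := fun a => by
    simpa using (mem_erase.1 a.2).2
  choose ind hind using hmem
  let back : Option A → Fin n := fun α => α.elim x fun a => v (ind a)
  obtain ⟨x', hxe, hxA, hτ⟩ := hE A (by simp [A])
    ((card_erase_le.trans card_image_le).trans (by simp))
    (Sym2.lift ⟨fun α β => decide (Rel M x (back α) (back β)), fun α β => by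
      simp only [rel_swap_right hM x (back α)]⟩)
  simp only [Sym2.lift_mk, decide_eq_decide] at hτ
  have hx' : ∀ o, x' ≠ point M' v' o := by
    rintro (_ | i)
    · exact hxe
    · rintro rfl
      exact hxA (mem_erase.2 ⟨hxe, mem_image_of_mem _ (mem_univ _)⟩)
  refine ⟨x', h.snoc_of_rel_iff hM hM' hx hx' ?_⟩
  set w := point M (Fin.snoc v x : Fin (m + 1) → Fin n)
  set w' := point M' (Fin.snoc v' x' : Fin (m + 1) → Fin n₁)
  have heq : ∀ i, x = w i ↔ x' = w' i := by
    intro i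
    rcases eq_castSucc_or_last i with ⟨p, rfl⟩ | rfl
    · simp [w, w', hx, hx']
    · simp [w, w']
  have key : ∀ i, (w i = M.2.1 ∧ w' i = M'.2.1) ∨
      ∃ α : Option A, back α = w i ∧ adjoin A x' α = w' i := by
    intro i
    rcases eq_castSucc_or_last i with ⟨_ | p, rfl⟩ | rfl
    · exact Or.inl ⟨rfl, rfl⟩
    · by_cases hp : v' p = M'.2.1
      · exact Or.inl ⟨by simpa [w, point] using (h.1 (some p) none).2 hp,
          by simpa [w', point] using hp⟩
      · let a : A := ⟨v' p, mem_erase.2 ⟨hp, mem_image_of_mem _ (mem_univ _)⟩⟩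
        refine Or.inr ⟨some a, ?_, ?_⟩
        · simpa [back, w, point] using (h.1 (some (ind a)) (some p)).2 (hind a)
        · simp [adjoin, w', point, a]
    · exact Or.inr ⟨none, by simp [back, w], by simp [adjoin, w']⟩
  intro i j
  rcases key i with ⟨hi, hi'⟩ | ⟨α, hα, hα'⟩
  · rw [hi, hi', rel_identity hM, rel_identity hM']
    exact heq j
  · rcases key j with ⟨hj, hj'⟩ | ⟨β, hβ, hβ'⟩
    · rw [hj, hj', rel_swap_right hM, rel_swap_right hM', rel_identity hM, rel_identity hM']
      exact heq i
    · rw [← hα, ← hα', ← hβ, ← hβ', hτ]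

end Types

section Transfer

open FirstOrder.Language

/-- Every term denotes `e` or one of the variables. -/
theorem exists_realize_term_eq_point {m : ℕ} (t : sigLang.Term (Empty ⊕ Fin m)) :
    ∃ o : Option (Fin m), ∀ (n : ℕ) (M : FSIASeData n), IsFSIASeOn M → ∀ v : Fin m → Fin n,
      @Term.realize sigLang (Fin n) (toStructure M) _ (Sum.elim default v) t = point M v o := by
  induction t with
  | var i =>
    rcases i with i | i
    · exact i.elim
    · exact ⟨some i, fun _ _ _ _ => rfl⟩
  | @func l F ts ih =>
    change SigFunc l at F
    cases F with
    | f =>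
      obtain ⟨o, ho⟩ := ih 0
      refine ⟨o, fun n M hM v => ?_⟩
      rw [← ho n M hM v]
      exact hM.1 _
    | e => exact ⟨none, fun _ _ _ _ => rfl⟩

theorem exists_realize_iff_of_hasExtensions {m : ℕ} (φ : sigLang.BoundedFormula Empty m) :
    ∃ K : ℕ, ∀ (n n₁ : ℕ) (M : FSIASeData n) (M' : FSIASeData n₁), IsFSIASeOn M →
      IsFSIASeOn M' → HasExtensions K M → HasExtensions K M' →
      ∀ (v : Fin m → Fin n) (v' : Fin m → Fin n₁), AtomEquiv M M' v v' →
      (@BoundedFormula.Realize sigLang (Fin n) (toStructure M) _ _ φ default v ↔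
        @BoundedFormula.Realize sigLang (Fin n₁) (toStructure M') _ _ φ default v') := by
  induction φ with
  | falsum => exact ⟨0, fun _ _ _ _ _ _ _ _ _ _ _ => Iff.rfl⟩
  | equal t₁ t₂ =>
    obtain ⟨o₁, h₁⟩ := exists_realize_term_eq_point t₁
    obtain ⟨o₂, h₂⟩ := exists_realize_term_eq_point t₂
    refine ⟨0, fun n n₁ M M' hM hM' _ _ v v' h => ?_⟩
    simp only [BoundedFormula.Realize]
    rw [h₁ n M hM, h₂ n M hM, h₁ n₁ M' hM', h₂ n₁ M' hM']
    exact h.1 _ _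
  | @rel m l R ts =>
    choose o ho using fun i => exists_realize_term_eq_point (ts i)
    change SigRel l at R
    cases R
    refine ⟨0, fun n n₁ M M' hM hM' _ _ v v' h => ?_⟩
    simp only [BoundedFormula.Realize]
    simp only [fun i => ho i n M hM v, fun i => ho i n₁ M' hM' v']
    exact h.2 (o 0) (o 1) (o 2)
  | imp φ ψ ihφ ihψ =>
    obtain ⟨K, hK⟩ := ihφ
    obtain ⟨L, hL⟩ := ihψ
    refine ⟨max K L, fun n n₁ M M' hM hM' hE hE' v v' h => ?_⟩
    simp only [BoundedFormula.Realize]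
    exact imp_congr
      (hK n n₁ M M' hM hM' (hE.mono (le_max_left _ _)) (hE'.mono (le_max_left _ _)) v v' h)
      (hL n n₁ M M' hM hM' (hE.mono (le_max_right _ _)) (hE'.mono (le_max_right _ _)) v v' h)
  | @all m φ ih =>
    obtain ⟨K, hK⟩ := ih
    refine ⟨max K m, fun n n₁ M M' hM hM' hE hE' v v' h => ?_⟩
    have hEK := hE.mono (le_max_left K m)
    have hEK' := hE'.mono (le_max_left K m)
    simp only [BoundedFormula.Realize]
    constructor
    · intro H x'
      obtain ⟨x, hx⟩ := h.symm.exists_snoc hM' hM (hE.mono (le_max_right K m)) x'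
      exact (hK n₁ n M' M hM' hM hEK' hEK _ _ hx).2 (H x)
    · intro H x
      obtain ⟨y, hx⟩ := h.exists_snoc hM hM' (hE'.mono (le_max_right K m)) x
      exact (hK n n₁ M M' hM hM' hEK hEK' _ _ hx).2 (H y)

/-- Structures with enough extensions agree on a given sentence. -/
theorem exists_satSentence_iff (σ : sigLang.Sentence) :
    ∃ K : ℕ, ∀ (n n₁ : ℕ) (M : FSIASeData n) (M' : FSIASeData n₁), IsFSIASeOn M →
      IsFSIASeOn M' → HasExtensions K M → HasExtensions K M' →
      (SatSentence M σ ↔ SatSentence M' σ) := by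
  obtain ⟨K, hK⟩ := exists_realize_iff_of_hasExtensions σ
  exact ⟨K, fun n n₁ M M' hM hM' hE hE' =>
    hK n n₁ M M' hM hM' hE hE' _ _ (atomEquiv_empty hM hM' _ _)⟩

end Transfer

section Asymptotics

theorem sub_card_le_card_outside (e : Fin n) (A : Finset (Fin n)) :
    n - (#A + 1) ≤ Fintype.card (Outside e A) := by
  have h : Fintype.card (Outside e A) = #(insert e A)ᶜ := by
    rw [Fintype.card_subtype]
    congr 1
    ext x
    simp
  rw [h, card_compl, Fintype.card_fin]
  have := card_insert_le e A
  omega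

/-- The bound for the number of bits describing a one-point type over at most `k` points. -/
def typeSize (k : ℕ) : ℕ := (k + 2).choose 2

/-- The bound for the probability that a given point misses a given type over `k` points. -/
noncomputable def missRatio (k : ℕ) : ℝ := 1 - (1 / 2) ^ typeSize k

theorem missRatio_pos (k : ℕ) : 0 < missRatio k := by
  have : typeSize k ≠ 0 := (Nat.choose_pos (by omega)).ne'
  have := pow_lt_one₀ (by norm_num : (0 : ℝ) ≤ 1 / 2) (by norm_num) this
  unfold missRatio
  linarith

theorem missRatio_lt_one (k : ℕ) : missRatio k < 1 := by
  have : (0 : ℝ) < (1 / 2) ^ typeSize k := by positivity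
  unfold missRatio
  linarith

theorem card_sym2_option_le {k : ℕ} {A : Finset (Fin n)} (hA : #A ≤ k) :
    Fintype.card (Sym2 (Option A)) ≤ typeSize k := by
  rw [Sym2.card, Fintype.card_option, Fintype.card_coe]
  exact Nat.choose_le_choose 2 (by omega)

theorem card_omitting_le_missRatio {k : ℕ} {e : Fin n} {A : Finset (Fin n)} (he : e ∉ A)
    (hA : #A ≤ k) (τ : Sym2 (Option A) → Bool) :
    (#{M : WithIdentity e | ∀ x, typeBits A M x ≠ τ} : ℝ) ≤
      missRatio k ^ (n - (k + 1)) * Fintype.card (WithIdentity e) := by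
  set y := Fintype.card (Sym2 (Option A))
  set X := Fintype.card (Outside e A)
  set N := #{M : WithIdentity e | ∀ x, typeBits A M x ≠ τ}
  have h : ((2 : ℝ) ^ y) ^ X * N ≤ Fintype.card (WithIdentity e) * (2 ^ y - 1) ^ X := by
    have := card_omitting_le he τ
    have h1 : 1 ≤ 2 ^ y := Nat.one_le_two_pow
    exact_mod_cast this
  have hy : 1 - (1 / 2 : ℝ) ^ y ≤ missRatio k := by
    have := pow_le_pow_of_le_one (by norm_num : (0 : ℝ) ≤ 1 / 2) (by norm_num)
      (card_sym2_option_le hA)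
    unfold missRatio
    linarith
  have hy0 : 0 ≤ 1 - (1 / 2 : ℝ) ^ y :=
    sub_nonneg.2 (pow_le_one₀ (by norm_num) (by norm_num))
  have hfac : (2 ^ y - 1 : ℝ) = 2 ^ y * (1 - (1 / 2) ^ y) := by
    rw [mul_sub, ← mul_pow]
    norm_num
  have hX : n - (k + 1) ≤ X := le_trans (by omega) (sub_card_le_card_outside e A)
  have hN : (N : ℝ) ≤ (1 - (1 / 2) ^ y) ^ X * Fintype.card (WithIdentity e) := by
    rw [hfac, mul_pow] at h
    have hpos : (0 : ℝ) < (2 ^ y) ^ X := by positivity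
    refine le_of_mul_le_mul_left (h.trans_eq ?_) hpos
    ring
  refine hN.trans (mul_le_mul_of_nonneg_right ?_ (by positivity))
  exact (pow_le_pow_left₀ hy0 hy X).trans
    (pow_le_pow_of_le_one (missRatio_pos k).le (missRatio_lt_one k).le hX)

theorem card_small_finsets_le (n k : ℕ) :
    #{A : Finset (Fin n) | #A ≤ k} ≤ ∑ j ∈ range (k + 1), n ^ j := by
  have : ({A : Finset (Fin n) | #A ≤ k} : Finset _) ⊆
      (range (k + 1)).biUnion fun j => powersetCard j univ := by
    intro A hA
    simp only [mem_filter, mem_univ, true_and] at hA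
    simp [mem_powersetCard, hA]
  refine (card_le_card this).trans (card_biUnion_le.trans (sum_le_sum fun j _ => ?_))
  rw [card_powersetCard, card_univ, Fintype.card_fin]
  exact Nat.choose_le_pow n j

/-- The union bound for the proportion of structures without extensions over `k` points. -/
noncomputable def failureBound (k n : ℕ) : ℝ :=
  (∑ j ∈ range (k + 1), (n : ℝ) ^ j) * 2 ^ typeSize k * missRatio k ^ (n - (k + 1))

open Classical in
theorem card_not_hasExtensions_withIdentity_le (k : ℕ) (e : Fin n) :
    (#{M : WithIdentity e | ¬ HasExtensions k M.1} : ℝ) ≤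
      failureBound k n * Fintype.card (WithIdentity e) := by
  set S : Finset (Finset (Fin n)) := {A | #A ≤ k ∧ e ∉ A}
  have hsub : ({M : WithIdentity e | ¬ HasExtensions k M.1} : Finset _) ⊆
      S.biUnion fun A => univ.biUnion fun τ : Sym2 (Option A) → Bool =>
        {M : WithIdentity e | ∀ x, typeBits A M x ≠ τ} := by
    intro M hM
    simp only [HasExtensions, mem_filter, mem_univ, true_and, not_forall] at hM
    obtain ⟨A, hA, hk, τ, hτ⟩ := hM
    rw [M.2.2] at hA
    simp only [mem_biUnion, mem_filter, mem_univ, true_and, S]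
    refine ⟨A, ⟨hk, hA⟩, τ, fun x hx => hτ ⟨x, ?_, x.2.2, fun α β => ?_⟩⟩
    · rw [M.2.2]
      exact x.2.1
    · rw [← typeBits_mk, hx]
  have hr := (missRatio_pos k).le
  set b : ℝ := missRatio k ^ (n - (k + 1)) * Fintype.card (WithIdentity e) with hb
  have hb0 : 0 ≤ b := by positivity
  calc (#{M : WithIdentity e | ¬ HasExtensions k M.1} : ℝ)
      ≤ ∑ A ∈ S, ∑ τ : Sym2 (Option A) → Bool,
          (#{M : WithIdentity e | ∀ x, typeBits A M x ≠ τ} : ℝ) := by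
        exact_mod_cast (card_le_card hsub).trans
          (card_biUnion_le.trans (sum_le_sum fun A _ => card_biUnion_le))
    _ ≤ ∑ A ∈ S, ∑ _τ : Sym2 (Option A) → Bool, b := by
        refine sum_le_sum fun A hA => sum_le_sum fun τ _ => ?_
        simp only [S, mem_filter, mem_univ, true_and] at hA
        exact card_omitting_le_missRatio hA.2 hA.1 τ
    _ ≤ ∑ _A ∈ S, 2 ^ typeSize k * b := by
        refine sum_le_sum fun A hA => ?_
        simp only [S, mem_filter, mem_univ, true_and] at hA
        rw [sum_const, card_univ, Fintype.card_fun, Fintype.card_bool, nsmul_eq_mul]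
        push_cast
        gcongr
        · norm_num
        · exact card_sym2_option_le hA.1
    _ = #S * (2 ^ typeSize k * b) := by rw [sum_const, nsmul_eq_mul]
    _ ≤ (∑ j ∈ range (k + 1), (n : ℝ) ^ j) * (2 ^ typeSize k * b) := by
        gcongr
        have : #S ≤ #{A : Finset (Fin n) | #A ≤ k} :=
          card_le_card fun A hA => by simp_all [S]
        exact_mod_cast this.trans (card_small_finsets_le n k)
    _ = failureBound k n * Fintype.card (WithIdentity e) := by
        rw [hb, failureBound]
        ring

/-- Sorting structures by their identity element. -/
def equivSigmaWithIdentity (P : FSIASeData n → Prop) :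
    {M : FSIASeData n // IsFSIASeOn M ∧ P M} ≃ Σ e : Fin n, {M : WithIdentity e // P M.1} where
  toFun M := ⟨M.1.2.1, ⟨M.1, M.2.1, rfl⟩, M.2.2⟩
  invFun M := ⟨M.2.1.1, M.2.1.2.1, M.2.2⟩
  left_inv _ := rfl
  right_inv := by
    rintro ⟨e, ⟨M, hM, rfl⟩, hP⟩
    rfl

theorem card_eq_sum_withIdentity (P : FSIASeData n → Prop) :
    Nat.card {M : FSIASeData n // IsFSIASeOn M ∧ P M} =
      ∑ e : Fin n, Nat.card {M : WithIdentity e // P M.1} := by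
  rw [Nat.card_congr (equivSigmaWithIdentity P), Nat.card_sigma]

theorem card_not_hasExtensions_le (k n : ℕ) :
    (Nat.card {M : FSIASeData n // IsFSIASeOn M ∧ ¬ HasExtensions k M} : ℝ) ≤
      failureBound k n * Nat.card {M : FSIASeData n // IsFSIASeOn M} := by
  classical
  have htot : Nat.card {M : FSIASeData n // IsFSIASeOn M} =
      ∑ e : Fin n, Fintype.card (WithIdentity e) := by
    have := card_eq_sum_withIdentity (n := n) fun _ => True
    simpa [Nat.card_eq_fintype_card] using this
  rw [htot, card_eq_sum_withIdentity, Nat.cast_sum, Nat.cast_sum, mul_sum]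
  refine sum_le_sum fun e _ => ?_
  rw [Nat.card_eq_fintype_card, Fintype.card_subtype]
  exact card_not_hasExtensions_withIdentity_le k e

theorem tendsto_failureBound (k : ℕ) : Tendsto (failureBound k) atTop (𝓝 0) := by
  have hr := missRatio_pos k
  have hlim : Tendsto (fun n : ℕ => (∑ j ∈ range (k + 1), (n : ℝ) ^ j * missRatio k ^ n) *
      (2 ^ typeSize k / missRatio k ^ (k + 1))) atTop (𝓝 0) := by
    have := tendsto_finsetSum (range (k + 1)) fun j _ =>
      tendsto_pow_const_mul_const_pow_of_lt_one j hr.le (missRatio_lt_one k)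
    simpa using this.mul_const (2 ^ typeSize k / missRatio k ^ (k + 1))
  refine squeeze_zero (fun n => ?_) (fun n => ?_) hlim
  · unfold failureBound
    positivity
  · have h : missRatio k ^ (n - (k + 1)) ≤ missRatio k ^ n / missRatio k ^ (k + 1) := by
      rw [le_div_iff₀ (by positivity), ← pow_add]
      exact pow_le_pow_of_le_one hr.le (missRatio_lt_one k).le (by omega)
    rw [← sum_mul]
    calc failureBound k n ≤ (∑ j ∈ range (k + 1), (n : ℝ) ^ j) * 2 ^ typeSize k *
          (missRatio k ^ n / missRatio k ^ (k + 1)) := by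
          unfold failureBound
          gcongr
      _ = _ := by ring

theorem exists_isFSIASeOn (hn : 0 < n) : ∃ M : FSIASeData n, IsFSIASeOn M := by
  let e : Fin n := ⟨0, hn⟩
  refine ⟨(id, e, univ.filter fun t => (t.1 = e ∧ t.2.1 = t.2.2) ∨
    (t.2.1 = e ∧ t.1 = t.2.2) ∨ (t.2.2 = e ∧ t.1 = t.2.1)), fun _ => rfl,
    fun a b c => ?_, fun a b => ?_⟩
  · simp
    grind
  · simp
    grind

/-- The fraction of the structures on `Fin n` having the property `P`. -/
noncomputable def fraction (n : ℕ) (P : FSIASeData n → Prop) : ℝ :=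
  (Nat.card {M : FSIASeData n // IsFSIASeOn M ∧ P M} : ℝ) /
    (Nat.card {M : FSIASeData n // IsFSIASeOn M} : ℝ)

theorem fraction_mono {P Q : FSIASeData n → Prop} (h : ∀ M, IsFSIASeOn M → P M → Q M) :
    fraction n P ≤ fraction n Q := by
  unfold fraction
  gcongr
  exact Nat.card_le_card_of_injective
    (fun M : {M : FSIASeData n // IsFSIASeOn M ∧ P M} =>
      (⟨M.1, M.2.1, h M.1 M.2.1 M.2.2⟩ : {M : FSIASeData n // IsFSIASeOn M ∧ Q M}))
    fun M N hMN => Subtype.ext (congrArg (fun K => K.1) hMN)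

theorem fraction_nonneg (P : FSIASeData n → Prop) : 0 ≤ fraction n P := by
  unfold fraction
  positivity

theorem fraction_not (hn : 0 < n) (P : FSIASeData n → Prop) :
    fraction n (fun M => ¬ P M) = 1 - fraction n P := by
  classical
  obtain ⟨M, hM⟩ := exists_isFSIASeOn hn
  have hne : (Nat.card {M : FSIASeData n // IsFSIASeOn M} : ℝ) ≠ 0 := by
    have : Nonempty {M : FSIASeData n // IsFSIASeOn M} := ⟨⟨M, hM⟩⟩
    exact_mod_cast Nat.card_pos.ne'
  have hsum : Nat.card {M : FSIASeData n // IsFSIASeOn M ∧ P M} +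
      Nat.card {M : FSIASeData n // IsFSIASeOn M ∧ ¬ P M} =
        Nat.card {M : FSIASeData n // IsFSIASeOn M} := by
    simp only [Nat.card_eq_fintype_card, Fintype.card_subtype, ← filter_filter]
    exact card_filter_add_card_filter_not _
  unfold fraction
  rw [eq_sub_iff_add_eq, ← add_div, div_eq_one_iff_eq hne, add_comm]
  exact_mod_cast hsum

theorem tendsto_fraction_not_hasExtensions (k : ℕ) :
    Tendsto (fun n => fraction n fun M => ¬ HasExtensions k M) atTop (𝓝 0) := by
  refine squeeze_zero (fun n => fraction_nonneg _) (fun n => ?_) (tendsto_failureBound k)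
  have hb : 0 ≤ failureBound k n := by
    have := missRatio_pos k
    unfold failureBound
    positivity
  exact div_le_of_le_mul₀ (by positivity) hb (card_not_hasExtensions_le k n)

end Asymptotics

end FSIASe

/-- The class `FSIAS_e` has a 0–1 law: for every first-order sentence in the
signature `{f, e, T}`, the fraction of labelled `FSIAS_e` structures satisfying
it tends either to 0 or to 1. -/
theorem stmt10 (σ : sigLang.Sentence) :
    Tendsto (fun n : ℕ =>
      (Nat.card {M : FSIASeData n // IsFSIASeOn M ∧ SatSentence M σ} : ℝ) /
      (Nat.card {M : FSIASeData n // IsFSIASeOn M} : ℝ)) atTop (𝓝 0) ∨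
    Tendsto (fun n : ℕ =>
      (Nat.card {M : FSIASeData n // IsFSIASeOn M ∧ SatSentence M σ} : ℝ) /
      (Nat.card {M : FSIASeData n // IsFSIASeOn M} : ℝ)) atTop (𝓝 1) := by
  change Tendsto (fun n => FSIASe.fraction n fun M => SatSentence M σ) atTop (𝓝 0) ∨
    Tendsto (fun n => FSIASe.fraction n fun M => SatSentence M σ) atTop (𝓝 1)
  obtain ⟨K, hK⟩ := FSIASe.exists_satSentence_iff σ
  have hlim := FSIASe.tendsto_fraction_not_hasExtensions K
  by_cases h : ∃ (n : ℕ) (M : FSIASeData n),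
      IsFSIASeOn M ∧ FSIASe.HasExtensions K M ∧ SatSentence M σ
  · obtain ⟨n₀, M₀, hM₀, hE₀, hσ₀⟩ := h
    right
    have hnot : Tendsto (fun n => FSIASe.fraction n fun M => ¬ SatSentence M σ) atTop (𝓝 0) :=
      squeeze_zero (fun n => FSIASe.fraction_nonneg _) (fun n => FSIASe.fraction_mono
        fun M hM hσ hE => hσ ((hK n₀ n M₀ M hM₀ hM hE₀ hE).1 hσ₀)) hlim
    have hsub := hnot.const_sub 1
    rw [sub_zero] at hsub
    refine hsub.congr' ?_
    filter_upwards [eventually_gt_atTop 0] with n hn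
    rw [FSIASe.fraction_not hn]
    ring
  · left
    exact squeeze_zero (fun n => FSIASe.fraction_nonneg _) (fun n => FSIASe.fraction_mono
      fun M hM hσ hE => h ⟨n, M, hM, hE, hσ⟩) hlim
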